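/- For a connected planar graph Γ, the graph hypersurface X_Γ (equivalently, the graph polynomial Ψ_Γ) is reducible if and only if Γ is separable with each component of a separation containing a cycle. The key algebraic step: if Ψ_Γ = p·q with p, q non-constant, then p and q use disjoint sets of variables (since Ψ_Γ has degree at most 1 in each variable tᵢ, for each i exactly one of p, q contains tᵢ), and combined with Whitney's lemma (a connected graph is non-separable iff any two edges lie on a common cycle) this forces Γ to be separable. -/

import Mathlib

/-- A multigraph: vertices `V`, edges `E`, each edge `e` has endpoints `fst e` and `snd e`
(loops and parallel edges allowed). -/
structure Multigraph where
  V : Type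
  E : Type
  fst : E → V
  snd : E → V

/-- Adjacency of two vertices through an edge belonging to the edge set `S`. -/
def Multigraph.adjIn (G : Multigraph) (S : Set G.E) (u v : G.V) : Prop :=
  ∃ e ∈ S, (G.fst e = u ∧ G.snd e = v) ∨ (G.fst e = v ∧ G.snd e = u)

/-- The edge set `S` connects the whole vertex set of `G`. -/
def Multigraph.ConnectsIn (G : Multigraph) (S : Set G.E) : Prop :=
  ∀ u v : G.V, Relation.ReflTransGen (G.adjIn S) u v

/-- A spanning tree of `G`: a minimal connecting edge set. -/
def Multigraph.IsSpanningTree (G : Multigraph) (S : Set G.E) : Prop :=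
  G.ConnectsIn S ∧ ∀ e ∈ S, ¬ G.ConnectsIn (S \ {e})

/-- The edge set `S` contains a cycle: some edge of `S` has its endpoints still
connected after its removal from `S`. -/
def Multigraph.HasCycleIn (G : Multigraph) (S : Set G.E) : Prop :=
  ∃ e ∈ S, Relation.ReflTransGen (G.adjIn (S \ {e})) (G.fst e) (G.snd e)

open scoped Classical in
/-- The Kirchhoff graph polynomial `Ψ_Γ = ∑_{T spanning tree} ∏_{e ∉ T} t_e`. -/
noncomputable def Multigraph.kirchhoff (G : Multigraph) [Fintype G.E] [DecidableEq G.E] :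
    MvPolynomial G.E ℤ :=
  ∑ T ∈ Finset.univ.filter (fun T : Finset G.E => G.IsSpanningTree ↑T),
    ∏ e ∈ Tᶜ, MvPolynomial.X e

/-- The graph hypersurface `X_Γ = {t ∈ ℙ^{n-1} | Ψ_Γ(t) = 0}`. -/
noncomputable def Multigraph.hypersurface (G : Multigraph) [Fintype G.E] [DecidableEq G.E]
    (k : Type) [Field k] : Set (Projectivization k (G.E → k)) :=
  {x | MvPolynomial.eval₂ (Int.castRingHom k) x.rep G.kirchhoff = 0}

/-- `Σ_n`, the union of the coordinate hyperplanes in `ℙ^{n-1}`. -/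
def coordHyperplanes (k : Type) [Field k] (E : Type) :
    Set (Projectivization k (E → k)) :=
  {x | ∃ e, x.rep e = 0}

namespace Multigraph

variable {G : Multigraph} {S T : Set G.E} {u v w : G.V}

/-- Two vertices are joined by a walk with edges in `S`. -/
def Reach (G : Multigraph) (S : Set G.E) : G.V → G.V → Prop :=
  Relation.ReflTransGen (G.adjIn S)

theorem hasCycleIn_iff : G.HasCycleIn S ↔ ∃ e ∈ S, G.Reach (S \ {e}) (G.fst e) (G.snd e) :=
  Iff.rfl

theorem ConnectsIn.reach (h : G.ConnectsIn S) (u v : G.V) : G.Reach S u v :=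
  h u v

@[refl]
theorem Reach.refl : G.Reach S u u :=
  Relation.ReflTransGen.refl

@[trans]
theorem Reach.trans (h : G.Reach S u v) (h' : G.Reach S v w) : G.Reach S u w :=
  Relation.ReflTransGen.trans h h'

@[symm]
theorem Reach.symm (h : G.Reach S u v) : G.Reach S v u := by
  induction h with
  | refl => exact .refl
  | tail _ h ih =>
    obtain ⟨e, he, h⟩ := h
    exact Relation.ReflTransGen.head ⟨e, he, h.symm⟩ ih

theorem Reach.of_edge {e : G.E} (he : e ∈ S) : G.Reach S (G.fst e) (G.snd e) :=
  Relation.ReflTransGen.single ⟨e, he, .inl ⟨rfl, rfl⟩⟩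

/-- Reachability in `S` is the least equivalence relation identifying the ends of each edge. -/
theorem Reach.rel_of_edges {r : G.V → G.V → Prop} (hr : Equivalence r)
    (hS : ∀ e ∈ S, r (G.fst e) (G.snd e)) (h : G.Reach S u v) : r u v := by
  induction h with
  | refl => exact hr.refl _
  | tail _ h ih =>
    obtain ⟨e, he, ⟨rfl, rfl⟩ | ⟨rfl, rfl⟩⟩ := h
    · exact hr.trans ih (hS e he)
    · exact hr.trans ih (hr.symm (hS e he))

theorem reach_equivalence (S : Set G.E) : Equivalence (G.Reach S) :=
  ⟨fun _ => .refl, .symm, .trans⟩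

theorem Reach.of_edges (hS : ∀ e ∈ S, G.Reach T (G.fst e) (G.snd e)) (h : G.Reach S u v) :
    G.Reach T u v :=
  h.rel_of_edges (reach_equivalence T) hS

theorem Reach.mono (hST : S ⊆ T) (h : G.Reach S u v) : G.Reach T u v :=
  h.of_edges fun _ he => .of_edge (hST he)

/-- A walk starting at `u` only uses edges reachable from `u`. -/
theorem Reach.restrict (h : G.Reach S u v) :
    G.Reach {e ∈ S | G.Reach S u (G.fst e)} u v := by
  induction h with
  | refl => exact .refl
  | tail huv h ih =>
    obtain ⟨e, he, ⟨rfl, rfl⟩ | ⟨rfl, rfl⟩⟩ := h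
    · exact ih.trans (.of_edge ⟨he, (huv : G.Reach S u _)⟩)
    · exact ih.trans (Reach.symm (.of_edge ⟨he, Reach.trans huv (Reach.of_edge he).symm⟩))

/-- A walk using the extra edge `e` can be shortened to use it at most once. -/
theorem Reach.of_insert {e : G.E} (h : G.Reach (insert e S) u v) :
    G.Reach S u v ∨ (G.Reach S u (G.fst e) ∧ G.Reach S (G.snd e) v) ∨
      (G.Reach S u (G.snd e) ∧ G.Reach S (G.fst e) v) := by
  induction h with
  | refl => exact .inl .refl
  | tail _ h ih =>
    obtain ⟨f, rfl | hf, h⟩ := h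
    · rcases h with ⟨rfl, rfl⟩ | ⟨rfl, rfl⟩
      · rcases ih with h | ⟨h, -⟩ | ⟨h, -⟩
        · exact .inr (.inl ⟨h, .refl⟩)
        · exact .inr (.inl ⟨h, .refl⟩)
        · exact .inl h
      · rcases ih with h | ⟨h, -⟩ | ⟨h, -⟩
        · exact .inr (.inr ⟨h, .refl⟩)
        · exact .inl h
        · exact .inr (.inr ⟨h, .refl⟩)
    · have hs : G.Reach S _ _ := Relation.ReflTransGen.single ⟨f, hf, h⟩
      rcases ih with h | ⟨h, h'⟩ | ⟨h, h'⟩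
      · exact .inl (h.trans hs)
      · exact .inr (.inl ⟨h, h'.trans hs⟩)
      · exact .inr (.inr ⟨h, h'.trans hs⟩)

/-- Distinct vertices joined in `S` are joined by a path `P` in `S`, which has an edge `e` whose ends
are linked to them without `e`. -/
theorem Reach.exists_edge [Finite G.E] (h : G.Reach S u v) (huv : u ≠ v) :
    ∃ P ⊆ S, ∃ e ∈ P,
      (G.Reach (P \ {e}) u (G.fst e) ∧ G.Reach (P \ {e}) (G.snd e) v) ∨
      (G.Reach (P \ {e}) u (G.snd e) ∧ G.Reach (P \ {e}) (G.fst e) v) := by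
  obtain ⟨P, hPS, hP⟩ :=
    (Set.toFinite {P : Set G.E | G.Reach P u v}).exists_le_minimal (a := S) h
  have hne : ∃ e, e ∈ P := by
    by_contra! hP'
    have : G.Reach P u v := hP.prop
    exact huv (this.rel_of_edges eq_equivalence fun e he => (hP' e he).elim)
  obtain ⟨e, he⟩ := hne
  refine ⟨P, hPS, e, he, ?_⟩
  have h1 : G.Reach (insert e (P \ {e})) u v := by
    rw [Set.insert_sdiff_singleton, Set.insert_eq_of_mem he]
    exact hP.prop
  refine h1.of_insert.resolve_left fun h2 => ?_
  exact (hP.le_of_le (y := P \ {e}) h2 Set.sdiff_subset he).2 rfl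

theorem HasCycleIn.mono (hST : S ⊆ T) : G.HasCycleIn S → G.HasCycleIn T := by
  simp only [hasCycleIn_iff]
  rintro ⟨e, he, h⟩
  exact ⟨e, hST he, h.mono (Set.sdiff_subset_sdiff_left hST)⟩

/-- Every acyclic subset of `S` extends to a spanning forest of `S`. -/
theorem exists_spanning_forest [Finite G.E] {F : Set G.E} (hFS : F ⊆ S)
    (hF : ¬ G.HasCycleIn F) :
    ∃ T, F ⊆ T ∧ T ⊆ S ∧ ¬ G.HasCycleIn T ∧ ∀ u v, G.Reach S u v → G.Reach T u v := by
  obtain ⟨T, hFT, hT⟩ :=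
    (Set.toFinite {T : Set G.E | T ⊆ S ∧ ¬ G.HasCycleIn T}).exists_le_maximal (a := F) ⟨hFS, hF⟩
  refine ⟨T, hFT, hT.prop.1, hT.prop.2, fun u v => Reach.of_edges fun e he => ?_⟩
  by_cases heT : e ∈ T
  · exact .of_edge heT
  have hcyc : G.HasCycleIn (insert e T) := by
    by_contra hc
    exact heT (hT.le_of_ge (y := insert e T) ⟨Set.insert_subset he hT.prop.1, hc⟩
      (Set.subset_insert e T) (Set.mem_insert e T))
  obtain ⟨f, hf, h⟩ := hasCycleIn_iff.1 hcyc
  by_cases hfe : f = e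
  · subst hfe
    exact h.mono (by simp)
  have hfT : f ∈ T := hf.resolve_left hfe
  rw [Set.insert_sdiff_of_notMem _ (by simpa using Ne.symm hfe)] at h
  have hd : T \ {f} ⊆ T := Set.sdiff_subset
  rcases h.of_insert with h | ⟨h, h'⟩ | ⟨h, h'⟩
  · exact (hT.prop.2 ⟨f, hfT, h⟩).elim
  · exact ((h.mono hd).symm.trans (.of_edge hfT)).trans (h'.mono hd).symm
  · exact ((h'.mono hd).trans (Reach.of_edge hfT).symm).trans (h.mono hd)

theorem IsSpanningTree.not_hasCycleIn (hT : G.IsSpanningTree T) : ¬ G.HasCycleIn T := by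
  rintro ⟨e, he, h⟩
  refine hT.2 e he fun u v => (hT.1.reach u v).of_edges fun f hf => ?_
  by_cases hfe : f = e
  · exact hfe ▸ h
  · exact .of_edge ⟨hf, hfe⟩

/-- In a connected graph, acyclic edge sets are the subsets of spanning trees. -/
theorem not_hasCycleIn_iff [Finite G.E] (hconn : G.ConnectsIn Set.univ) :
    ¬ G.HasCycleIn S ↔ ∃ T, S ⊆ T ∧ G.IsSpanningTree T := by
  constructor
  · intro h
    obtain ⟨T, hST, -, hT, hr⟩ := exists_spanning_forest (Set.subset_univ S) h
    exact ⟨T, hST, fun u v => hr u v (hconn u v), fun e he hc => hT ⟨e, he, hc _ _⟩⟩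
  · rintro ⟨T, hST, hT⟩ h
    exact hT.not_hasCycleIn (h.mono hST)

/-- If no cycle mixes edges of `A` with edges outside `A`, and both `A` and its complement
contain a cycle, then a single vertex separates two cycles. -/
theorem exists_separation [Fintype G.E] [DecidableEq G.E] (hconn : G.ConnectsIn Set.univ)
    {A : Set G.E}
    (hA : ∀ F₁ ⊆ A, ∀ F₂ ⊆ Aᶜ, ¬ G.HasCycleIn F₁ → ¬ G.HasCycleIn F₂ → ¬ G.HasCycleIn (F₁ ∪ F₂))
    (hcA : G.HasCycleIn A) (hcB : G.HasCycleIn Aᶜ) :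
    ∃ (W₁ W₂ : Set G.V) (a : G.V) (S : Finset G.E),
      W₁ ∪ W₂ = Set.univ ∧ W₁ ∩ W₂ = {a} ∧
      (∀ e ∈ S, G.fst e ∈ W₁ ∧ G.snd e ∈ W₁) ∧
      (∀ e ∈ Sᶜ, G.fst e ∈ W₂ ∧ G.snd e ∈ W₂) ∧
      G.HasCycleIn ↑S ∧ G.HasCycleIn ↑(Sᶜ) := by
  classical
  obtain ⟨e, heA, he⟩ := hasCycleIn_iff.1 hcA
  obtain ⟨f, hfA, hf⟩ := hasCycleIn_iff.1 hcB
  set X : Set G.E := {g ∈ A | G.Reach A (G.fst e) (G.fst g)}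
  have hXsnd : ∀ g ∈ X, G.Reach A (G.fst e) (G.snd g) :=
    fun g hg => hg.2.trans (.of_edge hg.1)
  have hBX : Aᶜ ⊆ Xᶜ := fun g hg hgX => hg hgX.1
  obtain ⟨a, haX, hfa⟩ : ∃ a, G.Reach A (G.fst e) a ∧ G.Reach Xᶜ (G.fst f) a := by
    have hfe := hconn (G.fst f) (G.fst e)
    generalize G.fst f = x at hfe
    induction hfe using Relation.ReflTransGen.head_induction_on with
    | refl => exact ⟨_, .refl, .refl⟩
    | head h _ ih =>
      obtain ⟨g, -, h⟩ := h
      by_cases hg : g ∈ X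
      · rcases h with ⟨rfl, rfl⟩ | ⟨rfl, rfl⟩
        · exact ⟨_, hg.2, .refl⟩
        · exact ⟨_, hXsnd g hg, .refl⟩
      · obtain ⟨a, ha, hr⟩ := ih
        exact ⟨a, ha, Relation.ReflTransGen.head ⟨g, hg, h⟩ hr⟩
  have hempty : ¬ G.HasCycleIn ∅ := fun ⟨_, h, _⟩ => h
  have hmeet : ∀ x, G.Reach A (G.fst e) x → G.Reach Xᶜ a x → x = a := by
    intro x hx hax
    by_contra hne
    obtain ⟨FA, -, hFA, hFAc, hFAr⟩ := exists_spanning_forest (Set.empty_subset A) hempty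
    obtain ⟨FB, -, hFB, hFBc, hFBr⟩ := exists_spanning_forest (Set.empty_subset Aᶜ) hempty
    obtain ⟨P, hP, g, hg, hPg⟩ :=
      (hFAr a x (haX.symm.trans hx)).exists_edge (Ne.symm hne)
    have hgX : g ∈ X := by
      refine ⟨hFA (hP hg), haX.trans ?_⟩
      have hsub : P \ {g} ⊆ A := (Set.sdiff_subset.trans hP).trans hFA
      rcases hPg with ⟨h, -⟩ | ⟨h, -⟩
      · exact h.mono hsub
      · exact (h.mono hsub).trans (Reach.of_edge (hFA (hP hg))).symm
    have hsub : P \ {g} ⊆ (FA ∪ FB) \ {g} :=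
      Set.sdiff_subset_sdiff_left (hP.trans Set.subset_union_left)
    have hax' : G.Reach ((FA ∪ FB) \ {g}) a x := by
      refine hax.of_edges fun k hk => ?_
      by_cases hkA : k ∈ A
      · refine (hFAr _ _ (.of_edge hkA)).restrict.mono ?_
        rintro l ⟨hl, hkl⟩
        refine ⟨.inl hl, ?_⟩
        rintro rfl
        exact hk ⟨hkA, hgX.2.trans (hkl.mono hFA).symm⟩
      · refine (hFBr _ _ (.of_edge hkA)).mono fun l hl => ⟨.inr hl, ?_⟩
        rintro rfl
        exact hFB hl hgX.1
    refine hA FA hFA FB hFB hFAc hFBc ⟨g, .inl (hP hg), ?_⟩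
    rcases hPg with ⟨h, h'⟩ | ⟨h, h'⟩
    · exact ((h.mono hsub).symm.trans hax').trans (h'.mono hsub).symm
    · exact ((h'.mono hsub).trans hax'.symm).trans (h.mono hsub)
  set W : Set G.V := {w | G.Reach Xᶜ a w}
  have hmem : ∀ g, g ∈ (Finset.univ.filter fun g => g ∈ Xᶜ ∧ G.fst g ∈ W)ᶜ ↔
      (g ∈ X ∨ G.fst g ∉ W) := by
    intro g
    simp only [Finset.mem_compl, Finset.mem_filter, Finset.mem_univ, true_and, Set.mem_compl_iff]
    tauto
  refine ⟨insert a Wᶜ, W, a, (Finset.univ.filter fun g => g ∈ Xᶜ ∧ G.fst g ∈ W)ᶜ,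
    ?_, ?_, ?_, ?_, ?_, ?_⟩
  · ext x; simp only [Set.mem_union, Set.mem_insert_iff, Set.mem_compl_iff, Set.mem_univ]; tauto
  · ext x
    have haW : a ∈ W := Reach.refl
    simp only [Set.mem_inter_iff, Set.mem_insert_iff, Set.mem_compl_iff, Set.mem_singleton_iff]
    constructor
    · tauto
    · rintro rfl; exact ⟨.inl rfl, haW⟩
  · intro g hg
    have key : ∀ x, G.Reach A (G.fst e) x → x ∈ insert a Wᶜ := fun x hx => by
      by_cases hxW : x ∈ W
      · exact .inl (hmeet x hx hxW)
      · exact .inr hxW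
    by_cases hgX : g ∈ X
    · exact ⟨key _ hgX.2, key _ (hXsnd g hgX)⟩
    · have h1 : G.fst g ∉ W := ((hmem g).1 hg).resolve_left hgX
      refine ⟨.inr h1, .inr fun h2 => h1 ?_⟩
      exact Reach.trans h2 (Reach.of_edge (S := Xᶜ) hgX).symm
  · intro g hg
    rw [compl_compl, Finset.mem_filter] at hg
    exact ⟨hg.2.2, Reach.trans hg.2.2 (.of_edge hg.2.1)⟩
  · have heX : e ∈ X := ⟨heA, .refl⟩
    refine ⟨e, (hmem e).2 (.inl heX), he.restrict.mono ?_⟩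
    rintro g ⟨hg, hr⟩
    exact ⟨(hmem g).2 (.inl ⟨hg.1, hr.mono Set.sdiff_subset⟩), hg.2⟩
  · rw [compl_compl]
    refine ⟨f, by simpa using ⟨hBX hfA, hfa.symm⟩, hf.restrict.mono ?_⟩
    rintro g ⟨hg, hr⟩
    refine ⟨?_, hg.2⟩
    simp only [Finset.coe_filter, Finset.mem_univ, true_and, Set.mem_ofPred_eq]
    exact ⟨hBX hg.1, hfa.symm.trans (hr.mono (Set.sdiff_subset.trans hBX))⟩

/-- Walks can be retracted onto one side of a separation at the vertex `a`. -/
theorem Reach.retract {W₁ W₂ : Set G.V} {a : G.V} {S : Set G.E} (hW : W₁ ∩ W₂ = {a})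
    (hS : ∀ e ∈ S, G.fst e ∈ W₁ ∧ G.snd e ∈ W₁) (hS' : ∀ e ∉ S, G.fst e ∈ W₂ ∧ G.snd e ∈ W₂)
    (hu : u ∈ W₁) (hv : v ∈ W₁) (h : G.Reach T u v) : G.Reach (T ∩ S) u v := by
  classical
  let r : G.V → G.V := fun x => if x ∈ W₁ then x else a
  have hr₁ : ∀ x ∈ W₁, r x = x := fun x hx => if_pos hx
  have hr₂ : ∀ x ∈ W₂, r x = a := fun x hx => by
    by_cases hx₁ : x ∈ W₁
    · have : x ∈ W₁ ∩ W₂ := ⟨hx₁, hx⟩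
      rw [hW] at this
      rw [hr₁ x hx₁]
      exact this
    · exact if_neg hx₁
  have key : G.Reach (T ∩ S) (r u) (r v) := by
    refine h.rel_of_edges (r := fun x y => G.Reach (T ∩ S) (r x) (r y))
      ((reach_equivalence (T ∩ S)).comap r) fun e he => ?_
    by_cases heS : e ∈ S
    · rw [hr₁ _ (hS e heS).1, hr₁ _ (hS e heS).2]
      exact .of_edge ⟨he, heS⟩
    · rw [hr₂ _ (hS' e heS).1, hr₂ _ (hS' e heS).2]
  rwa [hr₁ u hu, hr₁ v hv] at key

/-- The edge set `T` is minimal among those joining all vertices of `W` to each other. -/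
def IsTreeOn (G : Multigraph) (W : Set G.V) (T : Set G.E) : Prop :=
  Minimal (fun T => ∀ u ∈ W, ∀ v ∈ W, G.Reach T u v) T

theorem isSpanningTree_iff_isTreeOn : G.IsSpanningTree T ↔ G.IsTreeOn Set.univ T := by
  constructor
  · refine fun h => ⟨fun u _ v _ => h.1 u v, fun T' hT' hle e he => ?_⟩
    by_contra heT'
    refine h.2 e he fun u v => (hT' u trivial v trivial).mono fun f hf => ⟨hle hf, ?_⟩
    rintro rfl
    exact heT' hf
  · refine fun h => ⟨fun u v => h.prop u trivial v trivial, fun e he hc => ?_⟩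
    exact (h.le_of_le (y := T \ {e}) (fun u _ v _ => hc u v) Set.sdiff_subset he).2 rfl

/-- At a separating vertex, spanning trees are unions of spanning trees of the two sides. -/
theorem isSpanningTree_iff_of_separation {W₁ W₂ : Set G.V} {a : G.V} {S : Set G.E}
    (hU : W₁ ∪ W₂ = Set.univ) (hW : W₁ ∩ W₂ = {a})
    (hS : ∀ e ∈ S, G.fst e ∈ W₁ ∧ G.snd e ∈ W₁) (hS' : ∀ e ∉ S, G.fst e ∈ W₂ ∧ G.snd e ∈ W₂) :
    G.IsSpanningTree T ↔ G.IsTreeOn W₁ (T ∩ S) ∧ G.IsTreeOn W₂ (T ∩ Sᶜ) := by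
  have ha : a ∈ W₁ ∩ W₂ := hW ▸ rfl
  have hconn : ∀ T : Set G.E, (∀ u ∈ Set.univ, ∀ v ∈ Set.univ, G.Reach T u v) ↔
      (∀ u ∈ W₁, ∀ v ∈ W₁, G.Reach (T ∩ S) u v) ∧
        ∀ u ∈ W₂, ∀ v ∈ W₂, G.Reach (T ∩ Sᶜ) u v := by
    intro T
    constructor
    · intro h
      exact ⟨fun u hu v hv => (h u trivial v trivial).retract hW hS hS' hu hv,
        fun u hu v hv => (h u trivial v trivial).retract (by rwa [Set.inter_comm]) hS'
          (fun e he => hS e (not_not.1 he)) hu hv⟩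
    · rintro ⟨h₁, h₂⟩
      have hreach : ∀ u, G.Reach T u a := by
        intro u
        rcases hU.symm ▸ Set.mem_univ u with hu | hu
        · exact (h₁ u hu a ha.1).mono Set.inter_subset_left
        · exact (h₂ u hu a ha.2).mono Set.inter_subset_left
      exact fun u _ v _ => (hreach u).trans (hreach v).symm
  rw [isSpanningTree_iff_isTreeOn]
  constructor
  · intro h
    obtain ⟨h₁, h₂⟩ := (hconn T).1 h.prop
    refine ⟨⟨h₁, fun T' hT' hle => ?_⟩, ⟨h₂, fun T' hT' hle => ?_⟩⟩
    · have hT : T ⊆ T' ∪ T ∩ Sᶜ := by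
        refine h.le_of_le ((hconn _).2 ⟨?_, ?_⟩)
          (Set.union_subset (hle.trans Set.inter_subset_left) Set.inter_subset_left)
        · exact fun u hu v hv => (hT' u hu v hv).mono fun e he => ⟨.inl he, (hle he).2⟩
        · exact fun u hu v hv => (h₂ u hu v hv).mono fun e he => ⟨.inr he, he.2⟩
      exact fun e he => (hT he.1).resolve_right fun h => h.2 he.2
    · have hT : T ⊆ T ∩ S ∪ T' := by
        refine h.le_of_le ((hconn _).2 ⟨?_, ?_⟩)
          (Set.union_subset Set.inter_subset_left (hle.trans Set.inter_subset_left))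
        · exact fun u hu v hv => (h₁ u hu v hv).mono fun e he => ⟨.inl he, he.2⟩
        · exact fun u hu v hv => (hT' u hu v hv).mono fun e he => ⟨.inr he, (hle he).2⟩
      exact fun e he => (hT he.1).resolve_left fun h => he.2 h.2
  · rintro ⟨h₁, h₂⟩
    refine ⟨(hconn T).2 ⟨h₁.prop, h₂.prop⟩, fun T' hT' hle e he => ?_⟩
    obtain ⟨h₁', h₂'⟩ := (hconn T').1 hT'
    by_cases heS : e ∈ S
    · exact (h₁.le_of_le h₁' (Set.inter_subset_inter_left S hle) ⟨he, heS⟩).1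
    · exact (h₂.le_of_le h₂' (Set.inter_subset_inter_left Sᶜ hle) ⟨he, heS⟩).1

section Kirchhoff

variable [Fintype G.E] [DecidableEq G.E]

open MvPolynomial

/-- At the indicator of the complement of `F`, the Kirchhoff polynomial counts the spanning trees
containing `F`. -/
theorem eval_kirchhoff_ne_zero_iff (hconn : G.ConnectsIn Set.univ) (F : Set G.E)
    [DecidablePred (· ∈ F)] :
    eval (fun e => if e ∈ F then 0 else 1) G.kirchhoff ≠ 0 ↔ ¬ G.HasCycleIn F := by
  classical
  have hterm : ∀ T : Finset G.E, (∏ e ∈ Tᶜ, if e ∈ F then (0 : ℤ) else 1) =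
      if F ⊆ T then 1 else 0 := by
    intro T
    split_ifs with h
    · refine Finset.prod_eq_one fun e he => if_neg fun heF => ?_
      exact (Finset.mem_compl.1 he) (h heF)
    · obtain ⟨e, heF, heT⟩ := Set.not_subset.1 h
      exact Finset.prod_eq_zero (Finset.mem_compl.2 heT) (if_pos heF)
  simp only [kirchhoff, map_sum, map_prod, eval_X, hterm, Finset.sum_boole]
  rw [not_hasCycleIn_iff hconn, Nat.cast_ne_zero, Finset.card_ne_zero]
  constructor
  · rintro ⟨T, hT⟩
    simp only [Finset.mem_filter, Finset.mem_univ, true_and] at hT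
    exact ⟨T, hT.2, hT.1⟩
  · rintro ⟨T, hFT, hT⟩
    refine ⟨T.toFinset, ?_⟩
    simpa using ⟨hT, hFT⟩

theorem degreeOf_kirchhoff_le (e : G.E) : G.kirchhoff.degreeOf e ≤ 1 := by
  classical
  refine (degreeOf_sum_le _ _ _).trans (Finset.sup_le fun T _ => ?_)
  refine (degreeOf_prod_le _ _ _).trans ?_
  simp only [degreeOf_X, Finset.sum_ite_eq]
  split_ifs <;> simp

theorem exists_spanningTree_notMem {e : G.E} (he : e ∈ G.kirchhoff.vars) :
    ∃ T : Set G.E, G.IsSpanningTree T ∧ e ∉ T := by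
  classical
  obtain ⟨T, hT, heT⟩ := Finset.mem_biUnion.1 (vars_sum_subset _ _ he)
  obtain ⟨f, hf, hef⟩ := Finset.mem_biUnion.1 (vars_prod _ heT)
  rw [vars_X, Finset.mem_singleton] at hef
  subst hef
  exact ⟨T, (Finset.mem_filter.1 hT).2, by simpa using hf⟩

theorem separable_of_reducible (hconn : G.ConnectsIn Set.univ) {p q : MvPolynomial G.E ℤ}
    (hpq : G.kirchhoff = p * q) (hp : p.totalDegree ≠ 0) (hq : q.totalDegree ≠ 0) :
    ∃ (W₁ W₂ : Set G.V) (a : G.V) (S : Finset G.E),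
      W₁ ∪ W₂ = Set.univ ∧ W₁ ∩ W₂ = {a} ∧
      (∀ e ∈ S, G.fst e ∈ W₁ ∧ G.snd e ∈ W₁) ∧
      (∀ e ∈ Sᶜ, G.fst e ∈ W₂ ∧ G.snd e ∈ W₂) ∧
      G.HasCycleIn ↑S ∧ G.HasCycleIn ↑(Sᶜ) := by
  classical
  have hp0 : p ≠ 0 := by rintro rfl; simp at hp
  have hq0 : q ≠ 0 := by rintro rfl; simp at hq
  have hdeg : ∀ e, p.degreeOf e + q.degreeOf e = G.kirchhoff.degreeOf e := fun e => by
    rw [hpq, degreeOf_mul_eq hp0 hq0]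
  have hnonempty : ∀ r : MvPolynomial G.E ℤ, r.totalDegree ≠ 0 → r.vars.Nonempty := by
    intro r hr
    rw [Finset.nonempty_iff_ne_empty]
    exact fun h => hr (totalDegree_eq_zero_iff_eq_C.2 (vars_eq_empty_iff_eq_C.1 h))
  have hdisj : ∀ e ∈ q.vars, e ∉ p.vars := by
    intro e heq hep
    rw [mem_vars_iff_degreeOf_ne_zero] at heq hep
    have := hdeg e
    have := degreeOf_kirchhoff_le e
    omega
  set A : Set G.E := ↑p.vars
  have heval := eval_kirchhoff_ne_zero_iff hconn
  have hA : ∀ F₁ ⊆ A, ∀ F₂ ⊆ Aᶜ, ¬ G.HasCycleIn F₁ → ¬ G.HasCycleIn F₂ →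
      ¬ G.HasCycleIn (F₁ ∪ F₂) := by
    intro F₁ h₁ F₂ h₂ hc₁ hc₂
    rw [← heval, hpq, map_mul] at hc₁ hc₂ ⊢
    refine mul_ne_zero ?_ ?_
    · convert left_ne_zero_of_mul hc₁ using 1
      refine eval₂Hom_congr' rfl (fun e he _ => ?_) rfl
      have : e ∉ F₂ := fun h => h₂ h he
      simp [this]
    · convert right_ne_zero_of_mul hc₂ using 1
      refine eval₂Hom_congr' rfl (fun e he _ => ?_) rfl
      have : e ∉ F₁ := fun h => hdisj e he (h₁ h)
      simp [this]
  have hvars : ∀ e, e ∈ p.vars ∨ e ∈ q.vars → e ∈ G.kirchhoff.vars := by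
    intro e he
    simp only [mem_vars_iff_degreeOf_ne_zero] at he ⊢
    have := hdeg e
    omega
  have hcyc : ∀ e, e ∈ p.vars ∨ e ∈ q.vars → ∃ T, ¬ G.HasCycleIn T ∧
      G.HasCycleIn (insert e T) := by
    intro e he
    obtain ⟨T, hT, heT⟩ := exists_spanningTree_notMem (hvars e he)
    exact ⟨T, hT.not_hasCycleIn, e, Set.mem_insert e T, by
      rw [Set.insert_sdiff_self_of_notMem heT]; exact hT.1 _ _⟩
  refine exists_separation hconn hA ?_ ?_
  · obtain ⟨e, he⟩ := hnonempty p hp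
    obtain ⟨T, hT, hTc⟩ := hcyc e (.inl he)
    by_contra hc
    refine hA A subset_rfl (T \ A) (fun _ h => h.2) hc (fun h => hT (h.mono Set.sdiff_subset))
      (hTc.mono (Set.insert_subset (.inl he) ?_))
    rw [Set.union_sdiff_self]
    exact Set.subset_union_right
  · obtain ⟨e, he⟩ := hnonempty q hq
    obtain ⟨T, hT, hTc⟩ := hcyc e (.inr he)
    by_contra hc
    refine hA (T ∩ A) Set.inter_subset_right Aᶜ subset_rfl
      (fun h => hT (h.mono Set.inter_subset_left)) hc
      (hTc.mono (Set.insert_subset (.inr (hdisj e he)) fun f hf => ?_))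
    by_cases hfA : f ∈ A
    · exact .inl ⟨hf, hfA⟩
    · exact .inr hfA

open scoped Classical in
/-- The Kirchhoff polynomial of the subgraph with vertex set `W` and edge set `S`. -/
noncomputable def kirchhoffOn (G : Multigraph) [DecidableEq G.E] (W : Set G.V) (S : Finset G.E) :
    MvPolynomial G.E ℤ :=
  ∑ T ∈ S.powerset.filter (fun T : Finset G.E => G.IsTreeOn W ↑T), ∏ e ∈ S \ T, X e

theorem totalDegree_kirchhoffOn_ne_zero {W : Set G.V} {S : Finset G.E}
    (hW : ∀ u ∈ W, ∀ v ∈ W, G.Reach S u v) (hS : G.HasCycleIn ↑S) :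
    (G.kirchhoffOn W S).totalDegree ≠ 0 := by
  classical
  intro h0
  obtain ⟨c, hc⟩ : ∃ c, G.kirchhoffOn W S = C c := ⟨_, totalDegree_eq_zero_iff_eq_C.1 h0⟩
  have heq : eval (fun _ => 1) (G.kirchhoffOn W S) = eval (fun _ => 2) (G.kirchhoffOn W S) := by
    rw [hc, eval_C, eval_C]
  simp only [kirchhoffOn, map_sum, map_prod, eval_X, Finset.prod_const] at heq
  refine (Finset.sum_lt_sum (fun T _ => ?_) ?_).ne heq
  · exact pow_le_pow_left₀ (by norm_num) (by norm_num) _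
  · obtain ⟨e, heS, he⟩ := hasCycleIn_iff.1 hS
    have hWe : ∀ u ∈ W, ∀ v ∈ W, G.Reach ((↑S : Set G.E) \ {e}) u v := fun u hu v hv =>
      (hW u hu v hv).of_edges fun f hf => by
        by_cases hfe : f = e
        · exact hfe ▸ he
        · exact .of_edge ⟨hf, hfe⟩
    obtain ⟨T, hTS, hT⟩ := (Set.toFinite
      {T : Set G.E | ∀ u ∈ W, ∀ v ∈ W, G.Reach T u v}).exists_le_minimal (a := (↑S : Set G.E) \ {e}) hWe
    refine ⟨T.toFinset, ?_, ?_⟩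
    · simp only [Finset.mem_filter, Finset.mem_powerset, Set.coe_toFinset]
      exact ⟨fun f hf => (hTS (Set.mem_toFinset.1 hf)).1, hT⟩
    · rw [one_pow]
      refine one_lt_pow₀ (by norm_num) (Finset.card_ne_zero_of_mem (a := e) ?_)
      rw [Finset.mem_sdiff, Set.mem_toFinset]
      exact ⟨heS, fun h => (hTS h).2 rfl⟩

/-- The Kirchhoff polynomial is multiplicative along a separating vertex. -/
theorem kirchhoff_eq_mul {W₁ W₂ : Set G.V} {a : G.V} {S : Finset G.E}
    (hU : W₁ ∪ W₂ = Set.univ) (hW : W₁ ∩ W₂ = {a})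
    (hS : ∀ e ∈ S, G.fst e ∈ W₁ ∧ G.snd e ∈ W₁)
    (hS' : ∀ e ∈ Sᶜ, G.fst e ∈ W₂ ∧ G.snd e ∈ W₂) :
    G.kirchhoff = G.kirchhoffOn W₁ S * G.kirchhoffOn W₂ Sᶜ := by
  classical
  have htree : ∀ T : Finset G.E, G.IsSpanningTree ↑T ↔
      G.IsTreeOn W₁ ↑(T ∩ S) ∧ G.IsTreeOn W₂ ↑(T ∩ Sᶜ) := by
    intro T
    rw [isSpanningTree_iff_of_separation (S := ↑S) hU hW (by simpa using hS) (by simpa using hS')]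
    simp
  rw [kirchhoff, kirchhoffOn, kirchhoffOn, Finset.sum_mul_sum, ← Finset.sum_product']
  have hunion : ∀ T₁ ⊆ S, ∀ T₂ ⊆ Sᶜ, (T₁ ∪ T₂) ∩ S = T₁ ∧ (T₁ ∪ T₂) ∩ Sᶜ = T₂ := by
    intro T₁ h₁ T₂ h₂
    constructor <;> ext e <;> have := @h₁ e <;> have := @h₂ e <;>
      simp only [Finset.mem_inter, Finset.mem_union, Finset.mem_compl] at * <;> tauto
  refine Finset.sum_bij' (fun T _ => (T ∩ S, T ∩ Sᶜ)) (fun T _ => T.1 ∪ T.2) ?_ ?_ ?_ ?_ ?_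
  · intro T hT
    simpa [htree] using hT
  · rintro ⟨T₁, T₂⟩ hT
    simp only [Finset.mem_product, Finset.mem_filter, Finset.mem_powerset] at hT
    obtain ⟨⟨h₁, ht₁⟩, h₂, ht₂⟩ := hT
    obtain ⟨e₁, e₂⟩ := hunion T₁ h₁ T₂ h₂
    rw [Finset.mem_filter, htree, e₁, e₂]
    exact ⟨Finset.mem_univ _, ht₁, ht₂⟩
  · intro T _
    rw [← Finset.inter_union_distrib_left, Finset.union_compl, Finset.inter_univ]
  · rintro ⟨T₁, T₂⟩ hT
    simp only [Finset.mem_product, Finset.mem_filter, Finset.mem_powerset] at hT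
    obtain ⟨e₁, e₂⟩ := hunion T₁ hT.1.1 T₂ hT.2.1
    rw [e₁, e₂]
  · intro T _
    rw [← Finset.prod_union]
    · congr 1
      ext e
      simp only [Finset.mem_compl, Finset.mem_union, Finset.mem_sdiff, Finset.mem_inter]
      tauto
    · rw [Finset.disjoint_left]
      intro e h₁ h₂
      exact Finset.mem_compl.1 (Finset.mem_sdiff.1 h₂).1 (Finset.mem_sdiff.1 h₁).1

end Kirchhoff

end Multigraph

/-- for a connected graph `Γ`, the graph polynomial `Ψ_Γ`
(equivalently, the graph hypersurface `X_Γ`) is reducible — i.e. factors into two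
non-constant polynomials — if and only if `Γ` is separable (admits a decomposition
into two subgraphs, on vertex sets `W₁` and `W₂` with `W₁ ∩ W₂ = {a}` a single
separating vertex and edge sets `S` and `Sᶜ`) with each component of the
separation containing a cycle. -/
theorem kirchhoff_reducible_iff_separable_with_cycles
    (G : Multigraph) [Fintype G.V] [Fintype G.E] [DecidableEq G.E]
    (hconn : G.ConnectsIn Set.univ) :
    (∃ p q : MvPolynomial G.E ℤ,
        G.kirchhoff = p * q ∧ p.totalDegree ≠ 0 ∧ q.totalDegree ≠ 0) ↔
    ∃ (W₁ W₂ : Set G.V) (a : G.V) (S : Finset G.E),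
      W₁ ∪ W₂ = Set.univ ∧ W₁ ∩ W₂ = {a} ∧
      (∀ e ∈ S, G.fst e ∈ W₁ ∧ G.snd e ∈ W₁) ∧
      (∀ e ∈ Sᶜ, G.fst e ∈ W₂ ∧ G.snd e ∈ W₂) ∧
      G.HasCycleIn ↑S ∧ G.HasCycleIn ↑(Sᶜ) := by
  constructor
  · rintro ⟨p, q, hpq, hp, hq⟩
    exact Multigraph.separable_of_reducible hconn hpq hp hq
  · rintro ⟨W₁, W₂, a, S, hU, hW, hS, hS', hc, hc'⟩
    refine ⟨_, _, Multigraph.kirchhoff_eq_mul hU hW hS hS',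
      Multigraph.totalDegree_kirchhoffOn_ne_zero (fun u hu v hv => ?_) hc,
      Multigraph.totalDegree_kirchhoffOn_ne_zero (fun u hu v hv => ?_) hc'⟩
    · simpa using (hconn.reach u v).retract (S := ↑S) hW (by simpa using hS)
        (by simpa using hS') hu hv
    · simpa using (hconn.reach u v).retract (S := (↑S : Set G.E)ᶜ) (by rwa [Set.inter_comm])
        (by simpa using hS') (by simpa using hS) hu hv
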